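/- Let Σ ∈ ℂ^{N×N} be Hermitian positive semidefinite, let σ > 0, let S₁ ∈ ℂ^{m₁×N} and S₂ ∈ ℂ^{m₂×N}, and let S ∈ ℂ^{(m₁+m₂)×N} be the vertical stack of S₁ on top of S₂. Define Σ₁ = Σ − Σ S₁ᴴ (S₁ Σ S₁ᴴ + σ² I_{m₁})⁻¹ S₁ Σ and Σ_full = Σ − Σ Sᴴ (S Σ Sᴴ + σ² I_{m₁+m₂})⁻¹ S Σ. Then for every index n ∈ {1,…,N}, the diagonal entries satisfy Re(Σ_full(n,n)) ≤ Re(Σ₁(n,n)); consequently Re Tr(Σ_full) ≤ Re Tr(Σ₁). In words: the posterior variance of each port channel monotonically decreases as the number of measured ports increases. -/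

import Mathlib

open Matrix
open scoped ComplexOrder

/-- Adding a positive multiple of the identity to a congruence of a positive semidefinite matrix
gives a positive definite matrix. -/
lemma posDef_mul_mul_conjTranspose_add_smul_one {n m : Type*} [Fintype n] [Fintype m]
    [DecidableEq m] {K : Matrix n n ℂ} (hK : K.PosSemidef) {σ : ℝ} (hσ : 0 < σ)
    (S : Matrix m n ℂ) :
    (S * K * Sᴴ + ((σ : ℂ) ^ 2) • (1 : Matrix m m ℂ)).PosDef := by
  have hc : (0 : ℂ) < (σ : ℂ) ^ 2 := by exact_mod_cast pow_pos hσ 2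
  exact (PosDef.one.smul hc).posSemidef_add (hK.mul_mul_conjTranspose_same S)

/-- The inverse of a positive definite matrix dominates the embedded inverse of any invertible
compression of it. -/
lemma posSemidef_inv_sub_conjTranspose_mul_inv_mul {n m : Type*} [Fintype n] [Fintype m]
    [DecidableEq n] [DecidableEq m] {G : Matrix n n ℂ} (hG : G.PosDef) (P : Matrix m n ℂ)
    (hP : (P * G * Pᴴ).PosDef) :
    (G⁻¹ - Pᴴ * (P * G * Pᴴ)⁻¹ * P).PosSemidef := by
  set H := P * G * Pᴴ with hH
  set Q := Pᴴ * H⁻¹ * P with hQ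
  have hdG : IsUnit G.det := (isUnit_iff_isUnit_det _).1 hG.isUnit
  have hdH : IsUnit H.det := (isUnit_iff_isUnit_det _).1 hP.isUnit
  have hQQ : Q * G * Q = Q := by
    calc Q * G * Q = Pᴴ * (H⁻¹ * (P * G * Pᴴ)) * H⁻¹ * P := by simp only [hQ, Matrix.mul_assoc]
      _ = Q := by rw [← hH, nonsing_inv_mul _ hdH, Matrix.mul_one]
  have hQh : Q.IsHermitian := isHermitian_conjTranspose_mul_mul P hP.1.inv
  have hD : (G⁻¹ - Q)ᴴ * G * (G⁻¹ - Q) = G⁻¹ - Q := by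
    rw [(hG.1.inv.sub hQh).eq, Matrix.sub_mul, nonsing_inv_mul _ hdG, Matrix.mul_sub,
      Matrix.sub_mul, Matrix.sub_mul, Matrix.one_mul, Matrix.one_mul, hQQ, Matrix.mul_assoc Q,
      mul_nonsing_inv _ hdG, Matrix.mul_one, sub_self, sub_zero]
  rw [← hD]
  exact hG.posSemidef.conjTranspose_mul_mul_same _

/-- **Monotone decrease of posterior variances.** If `S` stacks `S₁` on top of
`S₂`, then every diagonal entry (posterior variance) of the full posterior
covariance is at most the corresponding diagonal entry of the partial one, and
consequently `Re Tr(Σ_full) ≤ Re Tr(Σ₁)`. -/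
theorem posterior_variance_monotone
    {N m₁ m₂ : ℕ}
    (K : Matrix (Fin N) (Fin N) ℂ) (hK : K.PosSemidef)
    (σ : ℝ) (hσ : 0 < σ)
    (S₁ : Matrix (Fin m₁) (Fin N) ℂ) (S₂ : Matrix (Fin m₂) (Fin N) ℂ)
    (S : Matrix (Fin m₁ ⊕ Fin m₂) (Fin N) ℂ) (hS : S = Matrix.fromRows S₁ S₂)
    (C₁ Cfull : Matrix (Fin N) (Fin N) ℂ)
    (hC₁ : C₁ = K - K * S₁ᴴ *
      (S₁ * K * S₁ᴴ + ((σ : ℂ) ^ 2) • (1 : Matrix (Fin m₁) (Fin m₁) ℂ))⁻¹ * S₁ * K)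
    (hCfull : Cfull = K - K * Sᴴ *
      (S * K * Sᴴ + ((σ : ℂ) ^ 2) • (1 : Matrix (Fin m₁ ⊕ Fin m₂) (Fin m₁ ⊕ Fin m₂) ℂ))⁻¹
        * S * K) :
    (∀ n : Fin N, (Cfull n n).re ≤ (C₁ n n).re) ∧
      Cfull.trace.re ≤ C₁.trace.re := by
  have hPS : S₁ =
      fromCols (1 : Matrix (Fin m₁) (Fin m₁) ℂ) (0 : Matrix (Fin m₁) (Fin m₂) ℂ) * S := by
    rw [hS, fromCols_mul_fromRows, Matrix.one_mul, Matrix.zero_mul, add_zero]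
  set P := fromCols (1 : Matrix (Fin m₁) (Fin m₁) ℂ) (0 : Matrix (Fin m₁) (Fin m₂) ℂ) with hP
  have hPP : P * Pᴴ = 1 := by
    rw [hP, conjTranspose_fromCols_eq_fromRows_conjTranspose, fromCols_mul_fromRows]
    simp
  have hG := posDef_mul_mul_conjTranspose_add_smul_one hK hσ S
  have hG₁ := posDef_mul_mul_conjTranspose_add_smul_one hK hσ S₁
  set G := S * K * Sᴴ + ((σ : ℂ) ^ 2) • (1 : Matrix (Fin m₁ ⊕ Fin m₂) (Fin m₁ ⊕ Fin m₂) ℂ)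
    with hGdef
  have hcomp : S₁ * K * S₁ᴴ + ((σ : ℂ) ^ 2) • (1 : Matrix (Fin m₁) (Fin m₁) ℂ) = P * G * Pᴴ := by
    rw [hGdef, Matrix.mul_add, Matrix.add_mul, Matrix.mul_smul, Matrix.smul_mul, Matrix.mul_one,
      hPP, hPS, conjTranspose_mul]
    simp only [Matrix.mul_assoc]
  rw [hcomp] at hC₁ hG₁
  have hdiff : C₁ - Cfull = (S * K)ᴴ * (G⁻¹ - Pᴴ * (P * G * Pᴴ)⁻¹ * P) * (S * K) := by
    rw [hC₁, hCfull, sub_sub_sub_cancel_left, hPS]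
    simp only [conjTranspose_mul, hK.1.eq, Matrix.mul_sub, Matrix.sub_mul, Matrix.mul_assoc]
  have hpsd : (C₁ - Cfull).PosSemidef := by
    rw [hdiff]
    exact (posSemidef_inv_sub_conjTranspose_mul_inv_mul hG P hG₁).conjTranspose_mul_mul_same _
  have hdiag (n : Fin N) : (Cfull n n).re ≤ (C₁ n n).re := by
    simpa using (Complex.le_def.1 (hpsd.diag_nonneg (i := n))).1
  refine ⟨hdiag, ?_⟩
  simpa only [trace, diag_apply, Complex.re_sum] using Finset.sum_le_sum fun n _ => hdiag n
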